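/- Let L be a field and m a natural number. Let J be an r × c matrix with entries in L[[t]], and suppose A and B are invertible matrices over L[[t]] (of sizes r × r and c × c respectively) such that D = A·J·B satisfies D_{ii} = t^{a_i} for 1 ≤ i ≤ s, with a_1 ≤ a_2 ≤ ⋯ ≤ a_s natural numbers, and all other entries of D zero. Let J_m be the r × c matrix over L[t]/(t^{m+1}) obtained by reducing the entries of J modulo t^{m+1}. Then for every k with 1 ≤ k ≤ s, the ideal of L[t]/(t^{m+1}) generated by all k × k minors of J_m is the principal ideal generated by the image of t^{min(a_1 + ⋯ + a_k, m+1)}; and for every k > s, the ideal of L[t]/(t^{m+1}) generated by all k × k minors of J_m is the zero ideal. -/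

import Mathlib

/-- The set of `k × k` minors of a matrix `M`: determinants of submatrices obtained by
choosing `k` rows and `k` columns. -/
def Matrix.minorsSet {R : Type*} [CommRing R] {r c : ℕ}
    (M : Matrix (Fin r) (Fin c) R) (k : ℕ) : Set R :=
  { d | ∃ (ρ : Fin k → Fin r) (γ : Fin k → Fin c),
      Function.Injective ρ ∧ Function.Injective γ ∧ d = (M.submatrix ρ γ).det }

/-- Reduction modulo `t^(m+1)`: the natural ring homomorphism
`L⟦t⟧ → L[t]/(t^(m+1))`, as a function. -/
noncomputable def truncMod (L : Type*) [Field L] (m : ℕ) (f : PowerSeries L) :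
    Polynomial L ⧸ Ideal.span {(Polynomial.X : Polynomial L) ^ (m + 1)} :=
  Ideal.Quotient.mk _ (PowerSeries.trunc (m + 1) f)

namespace Matrix

variable {R S : Type*} [CommRing R] [CommRing S] {n r c : ℕ}

theorem minorsSet_transpose (M : Matrix (Fin r) (Fin c) R) (k : ℕ) :
    Mᵀ.minorsSet k = M.minorsSet k := by
  ext d
  constructor
  · rintro ⟨ρ, γ, hρ, hγ, rfl⟩
    exact ⟨γ, ρ, hγ, hρ, by rw [← det_transpose]; rfl⟩
  · rintro ⟨ρ, γ, hρ, hγ, rfl⟩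
    exact ⟨γ, ρ, hγ, hρ, by rw [← det_transpose]; rfl⟩

theorem span_minorsSet_mul_le_right (M : Matrix (Fin r) (Fin n) R) (N : Matrix (Fin n) (Fin c) R)
    (k : ℕ) : Ideal.span ((M * N).minorsSet k) ≤ Ideal.span (N.minorsSet k) := by
  rw [Ideal.span_le]
  rintro _ ⟨ρ, γ, -, hγ, rfl⟩
  have h : ((M * N).submatrix ρ γ).det =
      ∑ f : Fin k → Fin n, (∏ i, M (ρ i) (f i)) * (N.submatrix f γ).det := by
    have hrows : (M * N).submatrix ρ γ = fun i => ∑ j, M (ρ i) j • fun l => N j (γ l) := by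
      ext i l
      simp [mul_apply, Finset.sum_apply]
    rw [hrows]
    change detRowAlternating.toMultilinearMap _ = _
    rw [MultilinearMap.map_sum]
    refine Finset.sum_congr rfl fun f _ => ?_
    rw [MultilinearMap.map_smul_univ, smul_eq_mul]
    rfl
  rw [h]
  refine sum_mem fun f _ => Ideal.mul_mem_left _ _ ?_
  by_cases hf : Function.Injective f
  · exact Ideal.subset_span ⟨f, γ, hf, hγ, rfl⟩
  · obtain ⟨i, j, hij, hne⟩ := Function.not_injective_iff.mp hf
    rw [det_zero_of_row_eq hne (by ext l; simp [hij])]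
    exact zero_mem _

theorem span_minorsSet_mul_le_left (M : Matrix (Fin r) (Fin n) R) (N : Matrix (Fin n) (Fin c) R)
    (k : ℕ) : Ideal.span ((M * N).minorsSet k) ≤ Ideal.span (M.minorsSet k) := by
  rw [← minorsSet_transpose (M * N), ← minorsSet_transpose M, transpose_mul]
  exact span_minorsSet_mul_le_right _ _ k

theorem span_minorsSet_mul_mul_le (A : Matrix (Fin r) (Fin r) R) (M : Matrix (Fin r) (Fin c) R)
    (B : Matrix (Fin c) (Fin c) R) (k : ℕ) :
    Ideal.span ((A * M * B).minorsSet k) ≤ Ideal.span (M.minorsSet k) :=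
  (span_minorsSet_mul_le_left _ _ k).trans (span_minorsSet_mul_le_right _ _ k)

theorem span_minorsSet_mul_mul_of_isUnit {A : Matrix (Fin r) (Fin r) R}
    (M : Matrix (Fin r) (Fin c) R) {B : Matrix (Fin c) (Fin c) R}
    (hA : IsUnit A.det) (hB : IsUnit B.det) (k : ℕ) :
    Ideal.span ((A * M * B).minorsSet k) = Ideal.span (M.minorsSet k) := by
  refine (span_minorsSet_mul_mul_le A M B k).antisymm ?_
  have hM : M = A⁻¹ * (A * M * B) * B⁻¹ := by
    rw [← Matrix.mul_assoc, mul_nonsing_inv_cancel_right _ _ hB,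
      nonsing_inv_mul_cancel_left _ _ hA]
  conv_lhs => rw [hM]
  exact span_minorsSet_mul_mul_le _ _ _ k

theorem minorsSet_map (f : R →+* S) (M : Matrix (Fin r) (Fin c) R) (k : ℕ) :
    (M.map f).minorsSet k = f '' M.minorsSet k := by
  ext d
  constructor
  · rintro ⟨ρ, γ, hρ, hγ, rfl⟩
    exact ⟨_, ⟨ρ, γ, hρ, hγ, rfl⟩, f.map_det _⟩
  · rintro ⟨_, ⟨ρ, γ, hρ, hγ, rfl⟩, rfl⟩
    exact ⟨ρ, γ, hρ, hγ, f.map_det _⟩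

end Matrix

theorem Monotone.sum_castLE_le_sum_comp {k s : ℕ} {a : Fin s → ℕ} (ha : Monotone a) (hks : k ≤ s)
    {g : Fin k → Fin s} (hg : Function.Injective g) :
    ∑ i : Fin k, a (Fin.castLE hks i) ≤ ∑ i, a (g i) := by
  have hcard : (Finset.univ.image g).card = k := by
    simp [Finset.card_image_of_injective _ hg]
  set e := (Finset.univ.image g).orderEmbOfFin hcard
  have hle (i : ℕ) : ∀ hi : i < k, i ≤ (e ⟨i, hi⟩ : ℕ) := by
    induction i with
    | zero => simp
    | succ i ih =>
      intro hi
      have hlt : e ⟨i, by omega⟩ < e ⟨i + 1, hi⟩ := e.strictMono (by simp)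
      have := ih (by omega)
      rw [Fin.lt_def] at hlt
      omega
  calc ∑ i : Fin k, a (Fin.castLE hks i) ≤ ∑ i, a (e i) :=
        Finset.sum_le_sum fun i _ => ha (hle i i.2)
    _ = ∑ x ∈ Finset.univ.image e, a x := (Finset.sum_image e.injective.injOn).symm
    _ = ∑ x ∈ Finset.univ.image g, a x := by rw [Finset.image_orderEmbOfFin_univ]
    _ = ∑ i, a (g i) := Finset.sum_image hg.injOn

section DiagonalForm

variable {R : Type*} [CommRing R] {r c s k : ℕ} {D : Matrix (Fin r) (Fin c) R}

theorem Matrix.exists_of_prod_ne_zero_of_diagonal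
    (hoff : ∀ (i : Fin r) (j : Fin c), ¬ ((i : ℕ) = (j : ℕ) ∧ (i : ℕ) < s) → D i j = 0)
    {ρ : Fin k → Fin r} {γ : Fin k → Fin c} (hγ : Function.Injective γ)
    (h : ∏ i, D (ρ i) (γ i) ≠ 0) :
    ∃ g : Fin k → Fin s, Function.Injective g ∧
      ∀ i, (ρ i : ℕ) = g i ∧ (γ i : ℕ) = g i := by
  have hi (i : Fin k) : (ρ i : ℕ) = (γ i : ℕ) ∧ (ρ i : ℕ) < s := by
    by_contra hc
    exact h (Finset.prod_eq_zero (Finset.mem_univ i) (hoff _ _ hc))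
  refine ⟨fun i => ⟨ρ i, (hi i).2⟩, fun i j hij => hγ ?_, fun i => ⟨rfl, (hi i).1.symm⟩⟩
  have := (hi i).1
  have := (hi j).1
  simp only [Fin.mk.injEq] at hij
  ext
  omega

theorem Matrix.span_minorsSet_eq_bot_of_diagonal
    (hoff : ∀ (i : Fin r) (j : Fin c), ¬ ((i : ℕ) = (j : ℕ) ∧ (i : ℕ) < s) → D i j = 0)
    (hk : s < k) : Ideal.span (D.minorsSet k) = ⊥ := by
  rw [Ideal.span_eq_bot]
  rintro _ ⟨ρ, γ, -, hγ, rfl⟩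
  rw [Matrix.det_apply]
  refine Finset.sum_eq_zero fun σ _ => ?_
  by_contra hne
  obtain ⟨g, hg, -⟩ := Matrix.exists_of_prod_ne_zero_of_diagonal (ρ := ρ ∘ σ) hoff hγ
    fun h0 => hne ((congrArg (Equiv.Perm.sign σ • ·) h0).trans (smul_zero _))
  have := Fintype.card_le_of_injective g hg
  simp only [Fintype.card_fin] at this
  omega

theorem Matrix.span_minorsSet_eq_span_pow_of_diagonal {x : R} (hsr : s ≤ r) (hsc : s ≤ c)
    {a : Fin s → ℕ} (ha : Monotone a)
    (hdiag : ∀ i : Fin s, D (Fin.castLE hsr i) (Fin.castLE hsc i) = x ^ a i)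
    (hoff : ∀ (i : Fin r) (j : Fin c), ¬ ((i : ℕ) = (j : ℕ) ∧ (i : ℕ) < s) → D i j = 0)
    (hks : k ≤ s) :
    Ideal.span (D.minorsSet k) = Ideal.span {x ^ ∑ i : Fin k, a (Fin.castLE hks i)} := by
  apply le_antisymm
  · rw [Ideal.span_le]
    rintro _ ⟨ρ, γ, -, hγ, rfl⟩
    rw [SetLike.mem_coe, Matrix.det_apply]
    refine sum_mem fun σ _ => Submodule.smul_of_tower_mem _ _ ?_
    simp only [Matrix.submatrix_apply]
    by_cases hne : ∏ i, D (ρ (σ i)) (γ i) = 0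
    · rw [hne]
      exact zero_mem _
    obtain ⟨g, hg, hgi⟩ := Matrix.exists_of_prod_ne_zero_of_diagonal (ρ := ρ ∘ σ) hoff hγ hne
    have hprod : ∏ i, D (ρ (σ i)) (γ i) = x ^ ∑ i, a (g i) := by
      rw [← Finset.prod_pow_eq_pow_sum]
      refine Finset.prod_congr rfl fun i _ => ?_
      have hrow : ρ (σ i) = Fin.castLE hsr (g i) := Fin.ext (hgi i).1
      have hcol : γ i = Fin.castLE hsc (g i) := Fin.ext (hgi i).2
      rw [hrow, hcol, hdiag]
    rw [hprod, Ideal.mem_span_singleton]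
    exact pow_dvd_pow _ (ha.sum_castLE_le_sum_comp hks hg)
  · rw [Ideal.span_singleton_le_iff_mem]
    refine Ideal.subset_span ⟨fun i => Fin.castLE hsr (Fin.castLE hks i),
      fun i => Fin.castLE hsc (Fin.castLE hks i), fun i j h => ?_, fun i j h => ?_, ?_⟩
    · simpa [Fin.ext_iff] using h
    · simpa [Fin.ext_iff] using h
    · have hdiagonal : D.submatrix (fun i => Fin.castLE hsr (Fin.castLE hks i))
          (fun i => Fin.castLE hsc (Fin.castLE hks i)) =
          Matrix.diagonal fun i => x ^ a (Fin.castLE hks i) := by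
        ext i j
        rcases eq_or_ne i j with rfl | hij
        · rw [Matrix.diagonal_apply_eq, ← hdiag, Matrix.submatrix_apply]
        · rw [Matrix.diagonal_apply_ne _ hij]
          refine hoff _ _ fun h => hij (Fin.ext ?_)
          simpa using h.1
      rw [hdiagonal, Matrix.det_diagonal, Finset.prod_pow_eq_pow_sum]

end DiagonalForm

section Truncation

variable (L : Type*) [Field L] (m : ℕ)

theorem truncMod_eq_mk_iff {f : PowerSeries L} {p : Polynomial L} :
    truncMod L m f = Ideal.Quotient.mk _ p ↔
      PowerSeries.trunc (m + 1) f = PowerSeries.trunc (m + 1) (p : PowerSeries L) := by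
  rw [truncMod, Ideal.Quotient.mk_eq_mk_iff_sub_mem, Ideal.mem_span_singleton,
    Polynomial.X_pow_dvd_iff, Polynomial.ext_iff]
  refine forall_congr' fun d => ?_
  by_cases hd : d < m + 1
  · simp [PowerSeries.coeff_trunc, hd, sub_eq_zero]
  · simp [PowerSeries.coeff_trunc, hd]

/-- Reduction of power series modulo `t^(m+1)` as a ring homomorphism. -/
noncomputable def truncModHom :
    PowerSeries L →+* Polynomial L ⧸ Ideal.span {(Polynomial.X : Polynomial L) ^ (m + 1)} where
  toFun := truncMod L m
  map_zero' := by simp [truncMod]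
  map_one' := by simp [truncMod]
  map_add' f g := by simp [truncMod]
  map_mul' f g := by
    refine Eq.trans ?_ (map_mul (Ideal.Quotient.mk _) _ _)
    rw [truncMod_eq_mk_iff, Polynomial.coe_mul, PowerSeries.trunc_trunc_mul_trunc]

theorem truncModHom_X_pow (e : ℕ) :
    truncModHom L m (PowerSeries.X ^ e) =
      Ideal.Quotient.mk _ ((Polynomial.X : Polynomial L) ^ min e (m + 1)) := by
  refine (truncMod_eq_mk_iff L m).mpr (Polynomial.ext fun d => ?_)
  simp only [PowerSeries.coeff_trunc, Polynomial.coe_pow, Polynomial.coe_X, PowerSeries.coeff_X_pow]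
  split_ifs <;> first | rfl | omega

end Truncation

/-- **Fitting ideals of a truncated matrix from a diagonal form.**
Let `J` be an `r × c` matrix over `L⟦t⟧` and `A`, `B` invertible matrices with
`D = A * J * B` diagonal with entries `t ^ (a 1), …, t ^ (a s)` (`a 1 ≤ ⋯ ≤ a s`) and zero
elsewhere. Let `J m` be the reduction of `J` modulo `t^(m+1)`. Then for `1 ≤ k ≤ s` the
ideal of `L[t]/(t^(m+1))` generated by the `k × k` minors of `J m` is generated by the image
of `t ^ min (a 1 + ⋯ + a k) (m+1)`, and it is zero for `k > s`. -/
theorem minors_ideal_of_trunc_of_diagonal_form {L : Type*} [Field L] {r c s : ℕ} (m : ℕ)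
    (hsr : s ≤ r) (hsc : s ≤ c)
    (J : Matrix (Fin r) (Fin c) (PowerSeries L))
    (A : Matrix (Fin r) (Fin r) (PowerSeries L))
    (B : Matrix (Fin c) (Fin c) (PowerSeries L))
    (hA : IsUnit A.det) (hB : IsUnit B.det)
    (a : Fin s → ℕ) (hmono : Monotone a)
    (hdiag : ∀ i : Fin s,
      (A * J * B) (Fin.castLE hsr i) (Fin.castLE hsc i) = (PowerSeries.X : PowerSeries L) ^ a i)
    (hoff : ∀ (i : Fin r) (j : Fin c), ¬ ((i : ℕ) = (j : ℕ) ∧ (i : ℕ) < s) →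
      (A * J * B) i j = 0) :
    (∀ (k : ℕ) (_ : 1 ≤ k) (hks : k ≤ s),
      Ideal.span ((J.map (truncMod L m)).minorsSet k) =
        Ideal.span {Ideal.Quotient.mk (Ideal.span {(Polynomial.X : Polynomial L) ^ (m + 1)})
          ((Polynomial.X : Polynomial L) ^ (min (∑ i : Fin k, a (Fin.castLE hks i)) (m + 1)))}) ∧
    (∀ k : ℕ, s < k → Ideal.span ((J.map (truncMod L m)).minorsSet k) = ⊥) := by
  have hspan (k : ℕ) : Ideal.span ((J.map (truncMod L m)).minorsSet k) =
      (Ideal.span ((A * J * B).minorsSet k)).map (truncModHom L m) := by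
    rw [Matrix.span_minorsSet_mul_mul_of_isUnit J hA hB, Ideal.map_span, ← Matrix.minorsSet_map]
    rfl
  refine ⟨fun k _ hks => ?_, fun k hk => ?_⟩
  · rw [hspan, Matrix.span_minorsSet_eq_span_pow_of_diagonal hsr hsc hmono hdiag hoff hks,
      Ideal.map_span, Set.image_singleton, truncModHom_X_pow]
  · rw [hspan, Matrix.span_minorsSet_eq_bot_of_diagonal hoff hk, Ideal.map_bot]
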